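/- arXiv:math/9907209 — 2 statements merged into one kernel-verified Lean document; each statement's English description precedes it below -/
import Mathlib

section
/- Let G be a complete normed abelian group and N ≥ 1. Then the following are equivalent: (1) every compactly supported G-valued Borel measure on ℝ^N with finite total variation is purely atomic; (2) every continuous path γ : [0,1] → G of finite length is constant. (This is Theorem 7.1 of the paper in the case k = 0, expressed via the identification of finite-mass flat 0-chains with compactly supported G-valued Borel measures of finite total variation given by Theorem 2.2.) -/
open MeasureTheory Set

/-- A `G`-valued vector measure has finite total variation: there is `C < ∞` such that
`∑ᵢ ‖ν(Sᵢ)‖ ≤ C` for every countable family of pairwise disjoint Borel sets. -/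
def HasFiniteTotalVariation {X : Type*} [MeasurableSpace X] {G : Type*} [NormedAddCommGroup G]
    (ν : VectorMeasure X G) : Prop :=
  ∃ C : ℝ, ∀ S : ℕ → Set X, (∀ i, MeasurableSet (S i)) →
    Pairwise (Function.onFun Disjoint S) →
    ∀ n : ℕ, ∑ i ∈ Finset.range n, ‖ν (S i)‖ ≤ C

/-- `ν` is compactly supported: there is a compact `K` with `ν B = 0` for every
Borel `B` disjoint from `K`. -/
def CompactlySupported {X : Type*} [MeasurableSpace X] [TopologicalSpace X]
    {G : Type*} [NormedAddCommGroup G] (ν : VectorMeasure X G) : Prop :=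
  ∃ K : Set X, IsCompact K ∧ ∀ B : Set X, MeasurableSet B → Disjoint B K → ν B = 0

/-- `ν` is purely atomic: there is a countable set `S` with `ν (B \ S) = 0` for every
Borel `B`. -/
def PurelyAtomic {X : Type*} [MeasurableSpace X] {G : Type*} [NormedAddCommGroup G]
    (ν : VectorMeasure X G) : Prop :=
  ∃ S : Set X, S.Countable ∧ ∀ B : Set X, MeasurableSet B → ν (B \ S) = 0

/-- `γ` has finite length on `[a, b]`: the sums `∑ ‖γ(tᵢ₊₁) - γ(tᵢ)‖` over all partitions
`a = t₀ ≤ t₁ ≤ ⋯ ≤ t_m = b` are bounded. -/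
def FiniteLengthOn {G : Type*} [NormedAddCommGroup G] (γ : ℝ → G) (a b : ℝ) : Prop :=
  ∃ C : ℝ, ∀ (m : ℕ) (t : ℕ → ℝ), Monotone t → t 0 = a → t m = b →
    ∑ i ∈ Finset.range m, ‖γ (t (i + 1)) - γ (t i)‖ ≤ C

open Filter Topology

section FiniteTotalVariation

variable {X Y : Type*} [MeasurableSpace X] [MeasurableSpace Y] {G : Type*} [NormedAddCommGroup G]

lemma sum_norm_le_of_pairwiseDisjoint {ν : VectorMeasure X G} {C : ℝ}
    (hC : ∀ S : ℕ → Set X, (∀ i, MeasurableSet (S i)) → Pairwise (Function.onFun Disjoint S) →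
      ∀ n : ℕ, ∑ i ∈ Finset.range n, ‖ν (S i)‖ ≤ C)
    {ι : Type*} (A : ι → Set X) (hA : ∀ i, MeasurableSet (A i))
    (hd : Pairwise (Function.onFun Disjoint A)) (u : Finset ι) :
    ∑ i ∈ u, ‖ν (A i)‖ ≤ C := by
  let e := u.equivFin
  let S : ℕ → Set X := fun k ↦ if h : k < u.card then A (e.symm ⟨k, h⟩) else ∅
  have hS k : MeasurableSet (S k) := by
    by_cases h : k < u.card <;> simp [S, h, hA]
  have hSd : Pairwise (Function.onFun Disjoint S) := by
    intro k l hkl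
    by_cases hk : k < u.card
    · by_cases hl : l < u.card
      · simp only [Function.onFun, S, hk, hl, dif_pos]
        refine hd fun h ↦ hkl ?_
        simpa using e.symm.injective (Subtype.ext h)
      · simp [Function.onFun, S, hl]
    · simp [Function.onFun, S, hk]
  calc ∑ i ∈ u, ‖ν (A i)‖ = ∑ i : u, ‖ν (A i)‖ := (Finset.sum_coe_sort u _).symm
    _ = ∑ k : Fin u.card, ‖ν (A (e.symm k))‖ := (e.symm.sum_comp fun i : u ↦ ‖ν (A i)‖).symm
    _ = ∑ k : Fin u.card, ‖ν (S k)‖ := by simp [S]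
    _ = ∑ k ∈ Finset.range u.card, ‖ν (S k)‖ := Fin.sum_univ_eq_sum_range (fun k ↦ ‖ν (S k)‖) _
    _ ≤ C := hC S hS hSd _

lemma HasFiniteTotalVariation.countable_setOf_singleton_ne_zero [MeasurableSingletonClass X]
    {ν : VectorMeasure X G} (hν : HasFiniteTotalVariation ν) : {x | ν {x} ≠ 0}.Countable := by
  obtain ⟨C, hC⟩ := hν
  have hs : Summable fun x : X ↦ ‖ν {x}‖ :=
    summable_of_sum_le (fun _ ↦ norm_nonneg _) fun u ↦
      sum_norm_le_of_pairwiseDisjoint hC (fun x : X ↦ {x}) measurableSet_singleton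
        (fun x y hxy ↦ by simpa [Function.onFun] using hxy) u
  simpa [Function.support] using hs.countable_support

lemma HasFiniteTotalVariation.restrict_map {ν : VectorMeasure X G}
    (hν : HasFiniteTotalVariation ν) {B : Set X} (hB : MeasurableSet B) {f : X → Y}
    (hf : Measurable f) : HasFiniteTotalVariation ((ν.restrict B).map f) := by
  obtain ⟨C, hC⟩ := hν
  refine ⟨C, fun S hS hd n ↦ ?_⟩
  simp only [VectorMeasure.map_apply _ hf (hS _), VectorMeasure.restrict_apply _ hB (hf (hS _))]
  exact hC _ (fun i ↦ (hf (hS i)).inter hB)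
    (fun i j hij ↦ ((hd hij).preimage f).mono inter_subset_left inter_subset_left) n

lemma HasFiniteTotalVariation.of_enorm_le {ν : VectorMeasure X G} {μ : Measure X}
    [IsFiniteMeasure μ] (h : ∀ s, ‖ν s‖ₑ ≤ μ s) : HasFiniteTotalVariation ν := by
  refine ⟨μ.real univ, fun S hS hd n ↦ ?_⟩
  have h' s : ‖ν s‖ ≤ μ.real s := by
    rw [← toReal_enorm]
    exact ENNReal.toReal_mono (measure_ne_top _ _) (h s)
  calc ∑ i ∈ Finset.range n, ‖ν (S i)‖ ≤ ∑ i ∈ Finset.range n, μ.real (S i) :=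
        Finset.sum_le_sum fun i _ ↦ h' _
    _ = μ.real (⋃ i ∈ Finset.range n, S i) :=
        (measureReal_biUnion_finset (fun i _ j _ hij ↦ hd hij) fun i _ ↦ hS i).symm
    _ ≤ μ.real univ := measureReal_mono (subset_univ _)

lemma vectorMeasure_apply_eq_zero_of_countable [MeasurableSingletonClass X]
    {ν : VectorMeasure X G} (h : ∀ x, ν {x} = 0) {s : Set X} (hs : s.Countable) : ν s = 0 := by
  have := VectorMeasure.of_biUnion (v := ν) (f := fun x : X ↦ {x}) hs
    (fun x _ y _ hxy ↦ by simpa [Function.onFun] using hxy) (fun x _ ↦ measurableSet_singleton x)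
  simpa [h] using this

end FiniteTotalVariation

section RealLine

variable {G : Type*} [NormedAddCommGroup G]

lemma vectorMeasure_Iic_sub_Iic (m : VectorMeasure ℝ G) {x y : ℝ} (h : x ≤ y) :
    m (Iic y) - m (Iic x) = m (Ioc x y) := by
  rw [← Iic_union_Ioc_eq_Iic h, VectorMeasure.of_union (Iic_disjoint_Ioc le_rfl)
    measurableSet_Iic measurableSet_Ioc]
  abel

lemma sum_norm_vectorMeasure_Iic_sub_le {m : VectorMeasure ℝ G} {C : ℝ}
    (hC : ∀ S : ℕ → Set ℝ, (∀ i, MeasurableSet (S i)) → Pairwise (Function.onFun Disjoint S) →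
      ∀ n : ℕ, ∑ i ∈ Finset.range n, ‖m (S i)‖ ≤ C)
    {t : ℕ → ℝ} (ht : Monotone t) (n : ℕ) :
    ∑ i ∈ Finset.range n, ‖m (Iic (t (i + 1))) - m (Iic (t i))‖ ≤ C := by
  simp only [vectorMeasure_Iic_sub_Iic m (ht (Nat.le_succ _))]
  exact hC _ (fun i ↦ measurableSet_Ioc) ht.pairwise_disjoint_on_Ioc_succ n

lemma eVariationOn_le_ofReal {f : ℝ → G} {C : ℝ}
    (h : ∀ t : ℕ → ℝ, Monotone t → ∀ n : ℕ, ∑ i ∈ Finset.range n, ‖f (t (i + 1)) - f (t i)‖ ≤ C) :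
    eVariationOn f univ ≤ ENNReal.ofReal C := by
  refine iSup_le fun p ↦ ?_
  simp only [edist_dist, dist_eq_norm]
  rw [← ENNReal.ofReal_sum_of_nonneg fun _ _ ↦ norm_nonneg _]
  exact ENNReal.ofReal_le_ofReal (h _ p.2.2.1 _)

lemma continuous_vectorMeasure_Iic [CompleteSpace G] {m : VectorMeasure ℝ G}
    (hm : HasFiniteTotalVariation m) (h0 : ∀ x, m {x} = 0) : Continuous fun x ↦ m (Iic x) := by
  obtain ⟨C, hC⟩ := hm
  have hbv : BoundedVariationOn (fun x ↦ m (Iic x)) univ :=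
    ne_top_of_le_ne_top ENNReal.ofReal_ne_top
      (eVariationOn_le_ofReal fun t ht n ↦ sum_norm_vectorMeasure_Iic_sub_le hC ht n)
  refine continuous_iff_continuousAt.2 fun x ↦
    continuousAt_iff_continuous_left'_right'.2 ⟨?_, ?_⟩
  · obtain ⟨u, u_mono, u_lt, hu⟩ := exists_seq_strictMono_tendsto_nhdsWithin x
    have hl := hbv.tendsto_leftLim x
    have hU : ⋃ n, Iic (u n) = Iio x := by
      refine Subset.antisymm (iUnion_subset fun n ↦ Iic_subset_Iio.2 (u_lt n)) fun y hy ↦ ?_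
      obtain ⟨n, hn⟩ := ((tendsto_nhds_of_tendsto_nhdsWithin hu).eventually_const_lt hy).exists
      exact mem_iUnion.2 ⟨n, hn.le⟩
    have h1 := VectorMeasure.tendsto_vectorMeasure_iUnion_atTop_nat (v := m)
      (s := fun n ↦ Iic (u n)) (fun i j hij ↦ Iic_subset_Iic.2 (u_mono.monotone hij))
      fun _ ↦ measurableSet_Iic
    have h2 : m (Iic x) = m (Iio x) := by
      rw [← Iio_union_right, VectorMeasure.of_union (by simp) measurableSet_Iio
        (measurableSet_singleton x), h0, add_zero]
    rw [hU, ← h2] at h1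
    rw [tendsto_nhds_unique (hl.comp hu) h1] at hl
    exact hl
  · obtain ⟨u, u_anti, u_gt, hu⟩ := exists_seq_strictAnti_tendsto_nhdsWithin x
    have hl := hbv.tendsto_rightLim x
    have hI : ⋂ n, Iic (u n) = Iic x := by
      refine Subset.antisymm (fun y hy ↦ ?_) (subset_iInter fun n ↦ Iic_subset_Iic.2 (u_gt n).le)
      exact ge_of_tendsto' (tendsto_nhds_of_tendsto_nhdsWithin hu) fun n ↦ mem_iInter.1 hy n
    have h1 := VectorMeasure.tendsto_vectorMeasure_iInter_atTop_nat (v := m)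
      (s := fun n ↦ Iic (u n)) (fun i j hij ↦ Iic_subset_Iic.2 (u_anti.antitone hij))
      fun _ ↦ measurableSet_Iic
    rw [hI] at h1
    rw [tendsto_nhds_unique (hl.comp hu) h1] at hl
    exact hl

lemma vectorMeasure_univ_eq_zero_of_paths_constant [CompleteSpace G]
    (hG : ∀ γ : ℝ → G, ContinuousOn γ (Icc 0 1) → FiniteLengthOn γ 0 1 →
      ∀ s ∈ Icc (0:ℝ) 1, ∀ t ∈ Icc (0:ℝ) 1, γ s = γ t)
    {m : VectorMeasure ℝ G} (hm : HasFiniteTotalVariation m) (h0 : ∀ x, m {x} = 0) :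
    m univ = 0 := by
  have hcont := continuous_vectorMeasure_Iic hm h0
  obtain ⟨C, hC⟩ := hm
  have hconst (n : ℕ) : m (Iic (-n : ℝ)) = m (Iic (n : ℝ)) := by
    have hmono : Monotone fun s : ℝ ↦ -(n : ℝ) + s * (2 * n) := fun s t hst ↦ by
      dsimp only
      gcongr
    have := hG (fun s ↦ m (Iic (-(n : ℝ) + s * (2 * n))))
      (hcont.comp (by fun_prop : Continuous fun s : ℝ ↦ -(n : ℝ) + s * (2 * n))).continuousOn
      ⟨C, fun k t ht _ _ ↦ sum_norm_vectorMeasure_Iic_sub_le hC (hmono.comp ht) k⟩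
      0 (by simp) 1 (by simp)
    convert this using 3 <;> ring
  have hU : ⋃ n : ℕ, Iic (n : ℝ) = univ := by
    refine eq_univ_of_forall fun x ↦ ?_
    obtain ⟨n, hn⟩ := exists_nat_ge x
    exact mem_iUnion.2 ⟨n, hn⟩
  have hI : ⋂ n : ℕ, Iic (-n : ℝ) = ∅ := by
    refine eq_empty_of_forall_notMem fun x hx ↦ ?_
    obtain ⟨n, hn⟩ := exists_nat_gt (-x)
    have := mem_iInter.1 hx n
    simp only [mem_Iic] at this
    linarith
  have h1 := VectorMeasure.tendsto_vectorMeasure_iUnion_atTop_nat (v := m)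
    (s := fun n : ℕ ↦ Iic (n : ℝ)) (fun i j hij ↦ Iic_subset_Iic.2 (Nat.cast_le.2 hij))
    fun _ ↦ measurableSet_Iic
  have h2 := VectorMeasure.tendsto_vectorMeasure_iInter_atTop_nat (v := m)
    (s := fun n : ℕ ↦ Iic (-n : ℝ))
    (fun i j hij ↦ Iic_subset_Iic.2 (neg_le_neg (Nat.cast_le.2 hij))) fun _ ↦ measurableSet_Iic
  simp only [hconst] at h2
  rw [hU] at h1
  rw [hI, VectorMeasure.empty] at h2
  exact tendsto_nhds_unique h1 h2

lemma FiniteLengthOn.boundedVariationOn_IccExtend {γ : ℝ → G} (hγ : FiniteLengthOn γ 0 1) :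
    BoundedVariationOn (IccExtend zero_le_one ((Icc (0 : ℝ) 1).domRestrict γ)) univ := by
  obtain ⟨C, hC⟩ := hγ
  refine ne_top_of_le_ne_top ENNReal.ofReal_ne_top
    (eVariationOn_le_ofReal (C := C) fun t ht n ↦ ?_)
  let p : ℝ → ℝ := fun x ↦ projIcc (0 : ℝ) 1 zero_le_one x
  have p0 x : 0 ≤ p x := (projIcc (0 : ℝ) 1 zero_le_one x).2.1
  have p1 x : p x ≤ 1 := (projIcc (0 : ℝ) 1 zero_le_one x).2.2
  have hp : Monotone p := fun x y hxy ↦ monotone_projIcc zero_le_one hxy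
  let q : ℕ → ℝ := fun i ↦ if i = 0 then 0 else if i ≤ n + 1 then p (t (i - 1)) else 1
  have hq : Monotone q := by
    refine monotone_nat_of_le_succ fun i ↦ ?_
    rcases Nat.eq_zero_or_pos i with rfl | hi
    · simp [q, p0]
    · have hi' : i ≠ 0 := hi.ne'
      by_cases h : i + 1 ≤ n + 1
      · have : i ≤ n + 1 := by omega
        simpa [q, hi', h, this] using hp (ht (by omega : i - 1 ≤ i))
      · by_cases h2 : i ≤ n + 1 <;> simp [q, hi', h, h2, p1]
  have hsum := hC (n + 2) q hq (by simp [q]) (by simp [q])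
  rw [Finset.sum_range_succ, Finset.sum_range_succ'] at hsum
  have heq : ∑ i ∈ Finset.range n, ‖γ (q (i + 1 + 1)) - γ (q (i + 1))‖ =
      ∑ i ∈ Finset.range n, ‖γ (p (t (i + 1))) - γ (p (t i))‖ := by
    refine Finset.sum_congr rfl fun i hi ↦ ?_
    have hi' := Finset.mem_range.1 hi
    have h1 : i + 1 + 1 ≤ n + 1 := by omega
    have h2 : i + 1 ≤ n + 1 := by omega
    simp [q, h1, h2]
  rw [heq] at hsum
  change ∑ i ∈ Finset.range n, ‖γ (p (t (i + 1))) - γ (p (t i))‖ ≤ C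
  linarith [norm_nonneg (γ (q (0 + 1)) - γ (q 0)), norm_nonneg (γ (q (n + 1 + 1)) - γ (q (n + 1)))]

lemma BoundedVariationOn.exists_vectorMeasure_of_continuous [CompleteSpace G] {f : ℝ → G}
    (hf : BoundedVariationOn f univ) (hc : Continuous f) :
    ∃ m : VectorMeasure ℝ G, HasFiniteTotalVariation m ∧
      (∀ u v, u ≤ v → m (Ioc u v) = f v - f u) ∧ ∀ x, m {x} = 0 := by
  have hr : f.rightLim = f := funext fun x ↦ hc.continuousWithinAt.rightLim_eq
  let F := hf.stieltjesFunctionRightLim 0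
  have : IsFiniteMeasure F.measure :=
    F.isFiniteMeasure_of_forall_abs_le (C := (eVariationOn f.rightLim univ).toReal)
      fun x ↦ variationOnFromTo.abs_le_eVariationOn hf.rightLim
  have hle : ∀ s ∈ {s | ∃ u v : ℝ, u ≤ v ∧ s = Ioc u v},
      ‖AddContent.onIoc f s‖ₑ ≤ F.measure s := by
    rintro s ⟨u, v, huv, rfl⟩
    rw [AddContent.onIoc_apply huv, StieltjesFunction.measure_Ioc]
    simp only [F, BoundedVariationOn.stieltjesFunctionRightLim_apply, hr]
    rw [← variationOnFromTo.add hf.locallyBoundedVariationOn (mem_univ 0) (mem_univ u)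
      (mem_univ v), add_sub_cancel_left, variationOnFromTo.eq_of_le _ _ huv,
      ENNReal.ofReal_toReal (hf.mono inter_subset_left), ← edist_eq_enorm_sub]
    exact eVariationOn.edist_le _ (by simp [huv]) (by simp [huv])
  have hgen : (inferInstance : MeasurableSpace ℝ) =
      MeasurableSpace.generateFrom {s | ∃ u v : ℝ, u ≤ v ∧ s = Ioc u v} := by
    rw [BorelSpace.measurable_eq (α := ℝ)]
    convert! borel_eq_generateFrom_Ioc_le ℝ using 2
    grind only
  obtain ⟨m, hm, hmle⟩ :=
    VectorMeasure.exists_extension_of_isSetSemiring_of_le_measure_of_generateFrom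
      IsSetSemiring.Ioc hle hgen
  have hIoc u v (huv : u ≤ v) : m (Ioc u v) = f v - f u := by
    rw [hm _ ⟨u, v, huv, rfl⟩, AddContent.onIoc_apply huv]
  refine ⟨m, .of_enorm_le hmle, hIoc, fun x ↦ ?_⟩
  obtain ⟨u, u_mono, u_lt, hu⟩ := exists_seq_strictMono_tendsto x
  have hI : ⋂ n, Ioc (u n) x = {x} := by
    refine Subset.antisymm (fun y hy ↦ ?_) (by simp [u_lt])
    simp only [mem_iInter, mem_Ioc] at hy
    exact le_antisymm (hy 0).2 (le_of_tendsto' hu fun n ↦ (hy n).1.le)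
  have h1 := VectorMeasure.tendsto_vectorMeasure_iInter_atTop_nat (v := m)
    (s := fun n ↦ Ioc (u n) x) (fun i j hij ↦ Ioc_subset_Ioc_left (u_mono.monotone hij))
    fun _ ↦ measurableSet_Ioc
  simp only [hIoc _ _ (u_lt _).le, hI] at h1
  refine tendsto_nhds_unique h1 ?_
  simpa using ((hc.tendsto x).comp hu).const_sub (f x)

end RealLine

lemma HasFiniteTotalVariation.purelyAtomic_of_paths_constant {X : Type*} [MeasurableSpace X]
    [StandardBorelSpace X] {G : Type*} [NormedAddCommGroup G] [CompleteSpace G]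
    (hG : ∀ γ : ℝ → G, ContinuousOn γ (Icc 0 1) → FiniteLengthOn γ 0 1 →
      ∀ s ∈ Icc (0:ℝ) 1, ∀ t ∈ Icc (0:ℝ) 1, γ s = γ t)
    {ν : VectorMeasure X G} (hν : HasFiniteTotalVariation ν) : PurelyAtomic ν := by
  refine ⟨{x | ν {x} ≠ 0}, hν.countable_setOf_singleton_ne_zero, fun B hB ↦ ?_⟩
  have hD : MeasurableSet (B \ {x | ν {x} ≠ 0}) :=
    hB.diff hν.countable_setOf_singleton_ne_zero.measurableSet
  obtain ⟨f, hf⟩ := exists_measurableEmbedding_real X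
  have key := vectorMeasure_univ_eq_zero_of_paths_constant hG
    (hν.restrict_map hD hf.measurable) fun x ↦ ?_
  · simpa [VectorMeasure.map_apply _ hf.measurable MeasurableSet.univ] using key
  rw [VectorMeasure.map_apply _ hf.measurable (measurableSet_singleton x),
    VectorMeasure.restrict_apply _ hD (hf.measurable (measurableSet_singleton x))]
  have hsub : (f ⁻¹' {x} ∩ (B \ {x | ν {x} ≠ 0})).Subsingleton :=
    (subsingleton_singleton.preimage hf.injective).anti inter_subset_left
  obtain h | ⟨y, h⟩ := hsub.eq_empty_or_singleton
  · rw [h, VectorMeasure.empty]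
  · have hy : y ∈ f ⁻¹' {x} ∩ (B \ {x | ν {x} ≠ 0}) := h ▸ mem_singleton y
    rw [h]
    exact not_not.1 hy.2.2

lemma path_constant_of_forall_purelyAtomic {X : Type*} [MeasurableSpace X] [TopologicalSpace X]
    [BorelSpace X] [T1Space X] {ι : ℝ → X} (hι : Continuous ι) (hinj : Function.Injective ι)
    {G : Type*} [NormedAddCommGroup G] [CompleteSpace G]
    (hX : ∀ ν : VectorMeasure X G,
      CompactlySupported ν → HasFiniteTotalVariation ν → PurelyAtomic ν)
    {γ : ℝ → G} (hγ : ContinuousOn γ (Icc 0 1)) (hlen : FiniteLengthOn γ 0 1)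
    {s t : ℝ} (hs : s ∈ Icc (0 : ℝ) 1) (ht : t ∈ Icc (0 : ℝ) 1) : γ s = γ t := by
  wlog hst : s ≤ t generalizing s t
  · exact (this ht hs (le_of_not_ge hst)).symm
  obtain ⟨m, hm, hIoc, h0⟩ := hlen.boundedVariationOn_IccExtend.exists_vectorMeasure_of_continuous
    (hγ.domRestrict.Icc_extend' (h := zero_le_one))
  have hmap B (hB : MeasurableSet B) :
      (m.restrict (Ioc s t)).map ι B = m (ι ⁻¹' B ∩ Ioc s t) := by
    rw [VectorMeasure.map_apply _ hι.measurable hB,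
      VectorMeasure.restrict_apply _ measurableSet_Ioc (hι.measurable hB)]
  obtain ⟨A, hA, hzero⟩ := hX ((m.restrict (Ioc s t)).map ι)
    ⟨ι '' Icc s t, isCompact_Icc.image hι, fun B hB hdisj ↦ by
      have : ι ⁻¹' B ∩ Ioc s t = ∅ := eq_empty_of_forall_notMem fun x hx ↦
        hdisj.le_bot ⟨hx.1, mem_image_of_mem ι (Ioc_subset_Icc_self hx.2)⟩
      rw [hmap B hB, this, VectorMeasure.empty]⟩
    (hm.restrict_map measurableSet_Ioc hι.measurable)
  have hatom : m (ι ⁻¹' A ∩ Ioc s t) = 0 :=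
    vectorMeasure_apply_eq_zero_of_countable h0 ((hA.preimage hinj).mono inter_subset_left)
  have hrest := hzero univ MeasurableSet.univ
  rw [hmap _ (MeasurableSet.univ.diff hA.measurableSet)] at hrest
  have hunion : ι ⁻¹' (univ \ A) ∩ Ioc s t ∪ ι ⁻¹' A ∩ Ioc s t = Ioc s t := by
    rw [← union_inter_distrib_right, ← preimage_union]
    simp
  have htotal : m (Ioc s t) = 0 := by
    rw [← hunion, VectorMeasure.of_union
      ((disjoint_sdiff_left.preimage ι).mono inter_subset_left inter_subset_left)
      ((hι.measurable (MeasurableSet.univ.diff hA.measurableSet)).inter measurableSet_Ioc)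
      ((hι.measurable hA.measurableSet).inter measurableSet_Ioc), hrest, hatom, add_zero]
  rw [hIoc s t hst, IccExtend_of_mem _ _ hs, IccExtend_of_mem _ _ ht] at htotal
  exact (sub_eq_zero.1 htotal).symm


/-- Theorem 7.1 of White, "Rectifiability of flat chains", in the case `k = 0`:
for a complete normed abelian group `G` and `N ≥ 1`, every compactly supported `G`-valued
Borel measure on `ℝ^N` of finite total variation is purely atomic if and only if
every continuous path of finite length in `G` is constant. -/
theorem rectifiability_of_zero_chains_iff_no_paths
    {G : Type*} [NormedAddCommGroup G] [CompleteSpace G] (N : ℕ) (hN : 1 ≤ N) :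
    (∀ ν : VectorMeasure (EuclideanSpace ℝ (Fin N)) G,
        CompactlySupported ν → HasFiniteTotalVariation ν → PurelyAtomic ν) ↔
    (∀ γ : ℝ → G, ContinuousOn γ (Icc 0 1) → FiniteLengthOn γ 0 1 →
        ∀ s ∈ Icc (0:ℝ) 1, ∀ t ∈ Icc (0:ℝ) 1, γ s = γ t) := by
  refine ⟨fun h γ hγ hlen s hs t ht ↦ ?_, fun hG ν _ hν ↦ hν.purelyAtomic_of_paths_constant hG⟩
  have hne : EuclideanSpace.single (⟨0, hN⟩ : Fin N) (1 : ℝ) ≠ 0 := by simp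
  exact path_constant_of_forall_purelyAtomic
    (ι := fun x : ℝ ↦ x • EuclideanSpace.single (⟨0, hN⟩ : Fin N) (1 : ℝ))
    (by fun_prop) (smul_left_injective ℝ hne) h hγ hlen hs ht
end

section
/- Let G be a complete normed abelian group, let ℓ > 0, and let γ : ℝ → G be a continuous map that is constant on (−∞, 0] and constant on [ℓ, ∞) and is parametrized by arc length on [0, ℓ], i.e., L(γ; s, t) = t − s for all 0 ≤ s ≤ t ≤ ℓ. Then there exists a G-valued Borel measure ν on ℝ such that ν((s, t]) = γ(t) − γ(s) for all real s ≤ t, and such that the total variation measure of ν is Lebesgue measure restricted to [0, ℓ]: for every Borel set S, the supremum of ∑ᵢ ‖ν(Sᵢ)‖ over all countable Borel partitions (Sᵢ) of S equals the Lebesgue measure of S ∩ [0, ℓ]. (This is the Stieltjes-type construction used in the proofs of Theorems 2.2 and 7.1.) -/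
open MeasureTheory Set

/-- The variation of a vector measure, as a supremum over countable measurable partitions. -/
theorem iSup_tsum_enorm_eq_variation {X : Type*} [MeasurableSpace X] {G : Type*}
    [NormedAddCommGroup G] (ν : VectorMeasure X G) {S : Set X} (hS : MeasurableSet S) :
    (⨆ (P : ℕ → Set X) (_ : ∀ i, MeasurableSet (P i))
        (_ : Pairwise (Function.onFun Disjoint P)) (_ : (⋃ i, P i) = S),
      ∑' i, (‖ν (P i)‖₊ : ENNReal)) = ν.variation S := by
  apply le_antisymm
  · simp only [iSup_le_iff]
    rintro P hP hd rfl
    rw [measure_iUnion hd hP]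
    exact ENNReal.tsum_le_tsum fun i ↦ ν.enorm_measure_le_variation (P i)
  · refine le_of_forall_lt fun a ha ↦ ?_
    obtain ⟨P, hPS, hPd, hPm, haP⟩ := ν.exists_lt_sum_of_lt_variation hS ha
    let f : Option P → Set X := fun o ↦ o.elim (S \ ⋃ p : P, (p : Set X)) (fun p ↦ p)
    have hfm : ∀ o, MeasurableSet (f o) := by
      rintro (_ | p)
      · exact hS.diff (MeasurableSet.iUnion fun p ↦ hPm p p.2)
      · exact hPm p p.2
    have hfd : Pairwise (Function.onFun Disjoint f) := by
      rintro (_ | p) (_ | q) hpq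
      · exact absurd rfl hpq
      · exact disjoint_sdiff_left.mono_right (subset_iUnion (fun p : P ↦ (p : Set X)) q)
      · exact disjoint_sdiff_right.mono_left (subset_iUnion (fun p : P ↦ (p : Set X)) p)
      · exact hPd p.2 q.2 fun h ↦ hpq (congrArg some (Subtype.ext h))
    have hfU : ⋃ o, f o = S := by
      rw [iUnion_option]
      exact sdiff_union_of_subset (iUnion_subset fun p ↦ hPS p p.2)
    let : Encodable (Option P) := Fintype.toEncodable _
    refine haP.trans_le (le_trans ?_ (le_iSup_of_le
      (fun i ↦ ⋃ o ∈ Encodable.decode₂ (Option P) i, f o) <| le_iSup_of_le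
      (fun i ↦ Encodable.iUnion_decode₂_cases (C := MeasurableSet) MeasurableSet.empty hfm) <| le_iSup_of_le
      (Encodable.iUnion_decode₂_disjoint_on hfd) <| le_iSup_of_le
      ((Encodable.iUnion_decode₂ f).trans hfU) le_rfl))
    rw [tsum_iUnion_decode₂ (fun s ↦ (‖ν s‖₊ : ENNReal)) (by simp) f, tsum_fintype,
      Fintype.sum_option, ← Finset.sum_coe_sort P]
    exact le_add_self

/-- The variation of a function on a set is at most the mass of any measure dominating its
increments. -/
theorem eVariationOn_le_measure_univ {G : Type*} [PseudoEMetricSpace G] {γ : ℝ → G}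
    {μ : Measure ℝ} (h : ∀ s t : ℝ, s ≤ t → edist (γ t) (γ s) ≤ μ (Ioc s t)) (A : Set ℝ) :
    eVariationOn γ A ≤ μ univ := by
  refine iSup_le fun ⟨n, u, hu, _⟩ ↦ ?_
  calc ∑ i ∈ Finset.range n, edist (γ (u (i + 1))) (γ (u i))
      ≤ ∑ i ∈ Finset.range n, μ (Ioc (u i) (u (i + 1))) :=
        Finset.sum_le_sum fun i _ ↦ h _ _ (hu i.le_succ)
    _ ≤ μ univ := sum_measure_le_measure_univ
        (fun i _ ↦ measurableSet_Ioc.nullMeasurableSet)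
        fun i _ j _ hij ↦ (hu.pairwise_disjoint_on_Ioc_succ hij).aedisjoint

/-- A function dominated by a finite measure on half-open intervals is the distribution function
of a vector measure dominated by the same measure. -/
theorem exists_vectorMeasure_Ioc_of_edist_le {G : Type*} [NormedAddCommGroup G] [CompleteSpace G]
    {γ : ℝ → G} {μ : Measure ℝ} [IsFiniteMeasure μ]
    (h : ∀ s t : ℝ, s ≤ t → edist (γ t) (γ s) ≤ μ (Ioc s t)) :
    ∃ ν : VectorMeasure ℝ G, (∀ s t : ℝ, s ≤ t → ν (Ioc s t) = γ t - γ s) ∧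
      ∀ S, ‖ν S‖ₑ ≤ μ S := by
  have hle : ∀ S ∈ {S : Set ℝ | ∃ u v, u ≤ v ∧ S = Ioc u v},
      ‖AddContent.onIoc γ S‖ₑ ≤ μ S := by
    rintro _ ⟨u, v, huv, rfl⟩
    rw [AddContent.onIoc_apply huv, ← edist_eq_enorm_sub]
    exact h u v huv
  have hgen : borel ℝ = MeasurableSpace.generateFrom {S : Set ℝ | ∃ u v, u ≤ v ∧ S = Ioc u v} := by
    convert! borel_eq_generateFrom_Ioc_le ℝ using 2
    grind only
  obtain ⟨ν, hν, hνμ⟩ :=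
    VectorMeasure.exists_extension_of_isSetSemiring_of_le_measure_of_generateFrom
      IsSetSemiring.Ioc hle ((BorelSpace.measurable_eq (α := ℝ)).trans hgen)
  exact ⟨ν, fun s t hst ↦ (hν _ ⟨s, t, hst, rfl⟩).trans (AddContent.onIoc_apply hst), hνμ⟩

/-- The Stieltjes-type construction used in the proofs of Theorems 2.2 and 7.1:
if `γ : ℝ → G` is continuous, constant on `(-∞, 0]` and on `[ℓ, ∞)`, and parametrized
by arc length on `[0, ℓ]` (i.e. `L(γ; s, t) = t - s` for `0 ≤ s ≤ t ≤ ℓ`), then there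
is a `G`-valued Borel measure `ν` on `ℝ` with `ν((s,t]) = γ(t) - γ(s)` whose total
variation measure is Lebesgue measure restricted to `[0, ℓ]`. -/
theorem exists_stieltjes_vectorMeasure_of_arcLength_path
    {G : Type*} [NormedAddCommGroup G] [CompleteSpace G]
    (ℓ : ℝ) (hℓ : 0 < ℓ) (γ : ℝ → G) (hc : Continuous γ)
    (h0 : ∀ t : ℝ, t ≤ 0 → γ t = γ 0) (h1 : ∀ t : ℝ, ℓ ≤ t → γ t = γ ℓ)
    (harc : ∀ s t : ℝ, 0 ≤ s → s ≤ t → t ≤ ℓ →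
      eVariationOn γ (Icc s t) = ENNReal.ofReal (t - s)) :
    ∃ ν : VectorMeasure ℝ G,
      (∀ s t : ℝ, s ≤ t → ν (Ioc s t) = γ t - γ s) ∧
      (∀ S : Set ℝ, MeasurableSet S →
        (⨆ (P : ℕ → Set ℝ) (_ : ∀ i, MeasurableSet (P i))
            (_ : Pairwise (Function.onFun Disjoint P)) (_ : (⋃ i, P i) = S),
          ∑' i, (‖ν (P i)‖₊ : ENNReal)) = volume (S ∩ Icc 0 ℓ)) := by
  have hproj : ∀ t, γ t = γ (projIcc 0 ℓ hℓ.le t) := fun t ↦ by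
    rcases le_total t 0 with ht | ht
    · rw [projIcc_of_le_left hℓ.le ht, h0 t ht]
    rcases le_total ℓ t with ht' | ht'
    · rw [projIcc_of_right_le hℓ.le ht', h1 t ht']
    · rw [projIcc_of_mem hℓ.le ⟨ht, ht'⟩]
  have hle : ∀ s t : ℝ, s ≤ t →
      edist (γ t) (γ s) ≤ volume.restrict (Icc 0 ℓ) (Ioc s t) := by
    intro s t hst
    have hst' := monotone_projIcc hℓ.le hst
    rw [hproj t, hproj s, Measure.restrict_apply measurableSet_Ioc]
    set a := projIcc 0 ℓ hℓ.le s with ha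
    set b := projIcc 0 ℓ hℓ.le t with hb
    refine (eVariationOn.edist_le γ (right_mem_Icc.2 hst') (left_mem_Icc.2 hst')).trans ?_
    rw [harc a b a.2.1 hst' b.2.2, ← Real.volume_Ioc]
    refine measure_mono fun x hx ↦ ?_
    have := a.2
    have := b.2
    simp only [ha, hb, coe_projIcc, mem_Ioc, mem_inter_iff, mem_Icc] at *
    grind
  obtain ⟨ν, hν, hνle⟩ := exists_vectorMeasure_Ioc_of_edist_le hle
  refine ⟨ν, hν, fun S hS ↦ ?_⟩
  have hvar_le : ν.variation ≤ volume.restrict (Icc 0 ℓ) :=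
    VectorMeasure.variation_le_of_forall_enorm_le fun E _ ↦ hνle E
  have : IsFiniteMeasure ν.variation := isFiniteMeasure_of_le _ hvar_le
  have hvar : ν.variation = volume.restrict (Icc 0 ℓ) := by
    refine Measure.eq_of_le_of_measure_univ_eq hvar_le (le_antisymm (hvar_le univ) ?_)
    rw [Measure.restrict_apply_univ, Real.volume_Icc, ← harc 0 ℓ le_rfl hℓ.le le_rfl]
    refine eVariationOn_le_measure_univ (fun s t hst ↦ ?_) _
    rw [edist_eq_enorm_sub, ← hν s t hst]
    exact ν.enorm_measure_le_variation _
  rw [iSup_tsum_enorm_eq_variation ν hS, hvar, Measure.restrict_apply hS]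
end
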